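/- arXiv:1809.10737 — 5 statements merged into one kernel-verified Lean document; each statement's English description precedes it below -/
import Mathlib

section
/- Let k ≥ 2 be a fixed integer, and let r : ℕ → ℝ be a positive function with r(n)·n^{k/(2k−2)} → 0 as n → ∞. Then the probability that the random geometric graph G(n, r(n)) contains a set of k vertices whose induced subgraph is connected tends to 0 as n → ∞. -/
open MeasureTheory Filter

noncomputable section

/-- The unit square `[0,1]²` in the Euclidean plane. -/
def unitSquare : Set (EuclideanSpace ℝ (Fin 2)) := {x | ∀ i, x i ∈ Set.Icc (0 : ℝ) 1}

/-- The distribution of `n` independent uniform points in the unit square. -/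
def sqMeasure (n : ℕ) : Measure (Fin n → EuclideanSpace ℝ (Fin 2)) :=
  Measure.pi fun _ => volume.restrict unitSquare

/-- The random geometric graph on `n` points `x 0, …, x (n-1)` with distance parameter `r`:
distinct `i`, `j` are adjacent iff `dist (x i) (x j) ≤ r`. -/
def geomGraph (n : ℕ) (r : ℝ) (x : Fin n → EuclideanSpace ℝ (Fin 2)) : SimpleGraph (Fin n) where
  Adj i j := i ≠ j ∧ dist (x i) (x j) ≤ r
  symm := ⟨fun i j h => ⟨h.1.symm, by rw [dist_comm]; exact h.2⟩⟩
  loopless := ⟨fun i h => h.1 rfl⟩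

theorem aux_square : volume unitSquare = 1 := by
  have h := EuclideanSpace.volume_preserving_symm_measurableEquiv_toLp (Fin 2)
  have e : unitSquare = (MeasurableEquiv.toLp 2 (Fin 2 → ℝ)).symm ⁻¹'
      (Set.pi Set.univ fun _ => Set.Icc (0:ℝ) 1) := by
    ext x
    simp only [unitSquare, Set.mem_preimage, Set.mem_pi, Set.mem_univ, true_imp_iff]
    rfl
  rw [e, h.measure_preimage_equiv, volume_pi_pi]
  simp

instance aux_prob : IsProbabilityMeasure
    ((volume : Measure (EuclideanSpace ℝ (Fin 2))).restrict unitSquare) :=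
  ⟨by simp [aux_square]⟩

theorem aux_star (n : ℕ) (v : Fin n) (T : Finset (Fin n)) (hv : v ∉ T) (R : ℝ) :
    sqMeasure n {x | ∀ i ∈ T, dist (x i) (x v) ≤ R} ≤
      (ENNReal.ofReal R ^ 2 * ENNReal.ofReal Real.pi) ^ T.card := by
  obtain _ | m := n
  · exact v.elim0
  set μ := (volume : Measure (EuclideanSpace ℝ (Fin 2))).restrict unitSquare with hμ
  have hp := measurePreserving_piFinSuccAbove (fun _ : Fin (m+1) => μ) v
  let A : Set (EuclideanSpace ℝ (Fin 2) × (Fin m → EuclideanSpace ℝ (Fin 2))) :=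
    {p | ∀ j, v.succAbove j ∈ T → dist (p.2 j) p.1 ≤ R}
  have hA : MeasurableSet A := by
    have : IsClosed A := by
      simp only [A, Set.ofPred_forall]
      refine isClosed_iInter fun j => isClosed_iInter fun _ => ?_
      exact isClosed_le (by fun_prop) (by fun_prop)
    exact this.measurableSet
  have e : {x : Fin (m+1) → EuclideanSpace ℝ (Fin 2) | ∀ i ∈ T, dist (x i) (x v) ≤ R} =
      (MeasurableEquiv.piFinSuccAbove (fun _ => EuclideanSpace ℝ (Fin 2)) v) ⁻¹' A := by
    ext x
    constructor
    · intro h j hj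
      exact h _ hj
    · intro h i hi
      have : i ≠ v := fun h => hv (h ▸ hi)
      obtain ⟨j, rfl⟩ := Fin.exists_succAbove_eq this
      exact h j hi
  rw [e, sqMeasure, hp.measure_preimage_equiv, Measure.prod_apply hA]
  calc _ ≤ ∫⁻ _, (ENNReal.ofReal R ^ 2 * ENNReal.ofReal Real.pi) ^ T.card ∂μ := by
        refine lintegral_mono fun a => ?_
        have e2 : Prod.mk a ⁻¹' A = Set.pi Set.univ fun j : Fin m =>
            if v.succAbove j ∈ T then Metric.closedBall a R else Set.univ := by
          ext y
          simp only [A, Set.mem_preimage, Set.mem_ofPred_eq, Set.mem_pi, Set.mem_univ, true_imp_iff]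
          refine forall_congr' fun j => ?_
          split_ifs with h <;> simp [h]
        rw [e2, Measure.pi_pi]
        have h3 : ∏ i : Fin (m+1), (if i ∈ T then (ENNReal.ofReal R ^ 2 * ENNReal.ofReal Real.pi) else 1) =
          (ENNReal.ofReal R ^ 2 * ENNReal.ofReal Real.pi) ^ T.card := by
          rw [Finset.prod_ite_mem]; simp
        rw [← h3, Fin.prod_univ_succAbove _ v, if_neg hv, one_mul]
        refine Finset.prod_le_prod' fun j _ => ?_
        split_ifs
        · refine (Measure.restrict_apply_le _ _).trans ?_
          rw [EuclideanSpace.volume_closedBall_fin_two]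
        · exact prob_le_one
    _ = _ := by simp

theorem aux_walk {n : ℕ} {r : ℝ} {x : Fin n → EuclideanSpace ℝ (Fin 2)} {S : Set (Fin n)}
    {u v : S} (w : ((geomGraph n r x).induce S).Walk u v) :
    dist (x u) (x v) ≤ w.length * r := by
  induction w with
  | nil => simp
  | cons h p ih =>
    have h2 : dist _ _ ≤ r := h.2
    refine (dist_triangle _ _ _).trans ((add_le_add h2 ih).trans ?_)
    simp only [SimpleGraph.Walk.length_cons]
    push_cast
    linarith

theorem aux_bound (k : ℕ) (hk : 2 ≤ k) (n : ℕ) (r : ℝ) (hr : 0 < r) :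
    sqMeasure n {x | ∃ S : Finset (Fin n), S.card = k ∧
          ((geomGraph n r x).induce (S : Set (Fin n))).Connected} ≤
    (n : ENNReal) ^ k * (ENNReal.ofReal (k * r) ^ 2 * ENNReal.ofReal Real.pi) ^ (k - 1) := by
  classical
  let P : Finset (Fin n × Finset (Fin n)) :=
    (Finset.univ ×ˢ Finset.univ.powersetCard (k-1)).filter fun p => p.1 ∉ p.2
  have hsub : {x | ∃ S : Finset (Fin n), S.card = k ∧
          ((geomGraph n r x).induce (S : Set (Fin n))).Connected} ⊆
      ⋃ p ∈ P, {x | ∀ i ∈ p.2, dist (x i) (x p.1) ≤ k * r} := by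
    rintro x ⟨S, hS, hc⟩
    have hne : S.Nonempty := by rw [← Finset.card_pos]; omega
    obtain ⟨v, hv⟩ := hne
    simp only [Set.mem_iUnion]
    refine ⟨(v, S.erase v), ?_, ?_⟩
    · simp [P, Finset.mem_powersetCard, Finset.card_erase_of_mem hv, hS]
    · intro i hi
      have hi' : i ∈ S := Finset.mem_of_mem_erase hi
      obtain ⟨w, hw⟩ := hc.exists_isPath ⟨i, hi'⟩ ⟨v, hv⟩
      have h1 := aux_walk w
      have h2 := hw.length_lt
      have h3 : Fintype.card ((S : Set (Fin n)) : Type) = k := by simp [hS]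
      rw [h3] at h2
      refine h1.trans ?_
      gcongr
  refine (measure_mono hsub).trans ((measure_biUnion_finset_le _ _).trans ?_)
  calc _ ≤ ∑ p ∈ P, (ENNReal.ofReal (k * r) ^ 2 * ENNReal.ofReal Real.pi) ^ (k - 1) := by
        refine Finset.sum_le_sum fun p hp => ?_
        simp only [P, Finset.mem_filter, Finset.mem_product, Finset.mem_powersetCard] at hp
        have := aux_star n p.1 p.2 hp.2 (k * r)
        rwa [hp.1.2.2] at this
    _ = (P.card : ENNReal) * (ENNReal.ofReal (k * r) ^ 2 * ENNReal.ofReal Real.pi) ^ (k - 1) := by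
        rw [Finset.sum_const, nsmul_eq_mul]
    _ ≤ _ := by
        gcongr
        have : P.card ≤ n ^ k := by
          refine (Finset.card_filter_le _ _).trans ?_
          rw [Finset.card_product, Finset.card_powersetCard, Finset.card_univ, Fintype.card_fin]
          calc n * n.choose (k-1) ≤ n * n ^ (k-1) := by gcongr; exact Nat.choose_le_pow _ _
            _ = n ^ k := by rw [← pow_succ']; congr 1; omega
        exact_mod_cast this

theorem connected_subgraph_subcritical (k : ℕ) (hk : 2 ≤ k) (r : ℕ → ℝ)
    (hrpos : ∀ n, 0 < r n)
    (hr : Tendsto (fun n : ℕ => r n * (n : ℝ) ^ ((k : ℝ) / (2 * (k : ℝ) - 2)))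
      atTop (nhds 0)) :
    Tendsto
      (fun n : ℕ => sqMeasure n
        {x | ∃ S : Finset (Fin n), S.card = k ∧
          ((geomGraph n (r n) x).induce (S : Set (Fin n))).Connected})
      atTop (nhds 0) := by
  have hlim : Tendsto (fun n : ℕ => ENNReal.ofReal (((k:ℝ) ^ 2 * Real.pi) ^ (k-1) *
      (r n * (n : ℝ) ^ ((k : ℝ) / (2 * (k : ℝ) - 2))) ^ (2 * (k - 1)))) atTop (nhds 0) := by
    have h := (hr.pow (2 * (k-1))).const_mul (((k:ℝ) ^ 2 * Real.pi) ^ (k-1))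
    rw [zero_pow (by omega), mul_zero] at h
    simpa using ENNReal.tendsto_ofReal h
  refine tendsto_of_tendsto_of_tendsto_of_le_of_le tendsto_const_nhds hlim
    (fun _ => zero_le) fun n => ?_
  refine (aux_bound k hk n (r n) (hrpos n)).trans (le_of_eq ?_)
  have hr0 := (hrpos n).le
  have h1 : (n : ENNReal) = ENNReal.ofReal (n : ℝ) := by simp
  rw [h1, ← ENNReal.ofReal_pow (by positivity), ← ENNReal.ofReal_pow (by positivity),
    ← ENNReal.ofReal_mul (by positivity), ← ENNReal.ofReal_pow (by positivity),
    ← ENNReal.ofReal_mul (by positivity)]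
  congr 1
  have h3 : ((n : ℝ) ^ ((k : ℝ) / (2 * (k : ℝ) - 2))) ^ (2 * (k - 1)) = (n : ℝ) ^ k := by
    rw [← Real.rpow_natCast, ← Real.rpow_mul (by positivity), ← Real.rpow_natCast _ k]
    congr 1
    have hk' : (2:ℝ) ≤ k := by exact_mod_cast hk
    rw [Nat.cast_mul, Nat.cast_sub (by omega)]
    push_cast
    have : (k:ℝ) - 1 ≠ 0 := by linarith
    rw [show 2 * (k:ℝ) - 2 = 2 * ((k:ℝ) - 1) by ring]
    field_simp
  rw [mul_pow (r n), h3, pow_mul]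
  simp only [mul_pow]
  ring
end
end

section
/- Let k ≥ 2 be a fixed integer, and let r : ℕ → ℝ be a positive function with r(n)·n^{k/(2k−2)} → ∞ as n → ∞. Then the probability that the random geometric graph G(n, r(n)) contains a set of k vertices whose induced subgraph is connected tends to 1 as n → ∞. -/
open MeasureTheory Filter

noncomputable section

def cnt {C : Type} [DecidableEq C] {N : ℕ} (u : Fin N → C) (c : C) : ℝ :=
  ∑ i, if u i = c then 1 else 0

lemma avg_one {C : Type} [Fintype C] [DecidableEq C] [Nonempty C] {N : ℕ} (i : Fin N) (c : C) :
    ∑ u : Fin N → C, ((Fintype.card C : ℝ)⁻¹) ^ N * (if u i = c then 1 else 0)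
      = (Fintype.card C : ℝ)⁻¹ := by
  have hM : (Fintype.card C : ℝ) ≠ 0 := by exact_mod_cast Fintype.card_ne_zero
  set q := (Fintype.card C : ℝ)⁻¹ with hq
  have h1 : ∀ u : Fin N → C, q ^ N * (if u i = c then (1:ℝ) else 0)
      = ∏ l, (q * (if l = i then (if u l = c then 1 else 0) else 1)) := by
    intro u
    rw [Finset.prod_mul_distrib, Finset.prod_ite_eq' Finset.univ i]
    simp
  rw [Finset.sum_congr rfl (fun u _ => h1 u)]
  rw [← Fintype.prod_sum (fun (l : Fin N) (x : C) =>
    q * (if l = i then (if x = c then (1:ℝ) else 0) else 1))]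
  have h2 : ∀ l : Fin N, ∑ x : C, q * (if l = i then (if x = c then (1:ℝ) else 0) else 1)
      = if l = i then q else 1 := by
    intro l
    by_cases h : l = i
    · simp [h]
    · simp [h, hq, hM]
  rw [Finset.prod_congr rfl (fun l _ => h2 l), Finset.prod_ite_eq' Finset.univ i]
  simp

lemma avg_two {C : Type} [Fintype C] [DecidableEq C] [Nonempty C] {N : ℕ} (i j : Fin N)
    (hij : i ≠ j) (c d : C) :
    ∑ u : Fin N → C, ((Fintype.card C : ℝ)⁻¹) ^ N *
      ((if u i = c then 1 else 0) * (if u j = d then 1 else 0))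
      = (Fintype.card C : ℝ)⁻¹ ^ 2 := by
  have hM : (Fintype.card C : ℝ) ≠ 0 := by exact_mod_cast Fintype.card_ne_zero
  set q := (Fintype.card C : ℝ)⁻¹ with hq
  have h1 : ∀ u : Fin N → C, q ^ N *
      ((if u i = c then (1:ℝ) else 0) * (if u j = d then 1 else 0))
      = ∏ l, (q * ((if l = i then (if u l = c then 1 else 0) else 1) *
        (if l = j then (if u l = d then 1 else 0) else 1))) := by
    intro u
    rw [Finset.prod_mul_distrib, Finset.prod_mul_distrib, Finset.prod_ite_eq' Finset.univ i,
      Finset.prod_ite_eq' Finset.univ j]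
    simp
  rw [Finset.sum_congr rfl (fun u _ => h1 u)]
  rw [← Fintype.prod_sum (fun (l : Fin N) (x : C) =>
    q * ((if l = i then (if x = c then (1:ℝ) else 0) else 1) *
        (if l = j then (if x = d then 1 else 0) else 1)))]
  have h2 : ∀ l : Fin N, ∑ x : C, q * ((if l = i then (if x = c then (1:ℝ) else 0) else 1) *
        (if l = j then (if x = d then 1 else 0) else 1))
      = (if l = i then q else 1) * (if l = j then q else 1) := by
    intro l
    by_cases h : l = i
    · subst h; simp [hij]
    · by_cases h' : l = j
      · subst h'; simp [h]
      · simp [h, h', hq, hM]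
  rw [Finset.prod_congr rfl (fun l _ => h2 l), Finset.prod_mul_distrib,
    Finset.prod_ite_eq' Finset.univ i, Finset.prod_ite_eq' Finset.univ j]
  simp [sq]

lemma avg_cnt {C : Type} [Fintype C] [DecidableEq C] [Nonempty C] {N : ℕ} (c : C) :
    ∑ u : Fin N → C, ((Fintype.card C : ℝ)⁻¹) ^ N * cnt u c
      = N * (Fintype.card C : ℝ)⁻¹ := by
  simp only [cnt, Finset.mul_sum]
  rw [Finset.sum_comm]
  have := fun i : Fin N => avg_one i c
  simp only [this]
  simp

lemma avg_cnt2 {C : Type} [Fintype C] [DecidableEq C] [Nonempty C] {N : ℕ} (c d : C) :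
    ∑ u : Fin N → C, ((Fintype.card C : ℝ)⁻¹) ^ N * (cnt u c * cnt u d)
      ≤ (N * (Fintype.card C : ℝ)⁻¹) ^ 2
        + if c = d then N * (Fintype.card C : ℝ)⁻¹ else 0 := by
  have h0 : ∀ u : Fin N → C, ((Fintype.card C : ℝ)⁻¹) ^ N * (cnt u c * cnt u d)
     = ∑ i, ∑ j, ((Fintype.card C : ℝ)⁻¹) ^ N *
      ((if u i = c then 1 else 0) * (if u j = d then 1 else 0)) := by
    intro u
    simp only [cnt]
    rw [Finset.sum_mul_sum]
    simp only [Finset.mul_sum]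
  rw [Finset.sum_congr rfl (fun u _ => h0 u), Finset.sum_comm]
  have h1 : ∀ i : Fin N, ∑ u : Fin N → C, ∑ j, ((Fintype.card C : ℝ)⁻¹) ^ N *
      ((if u i = c then (1:ℝ) else 0) * (if u j = d then 1 else 0)) ≤
      ∑ j : Fin N, ((Fintype.card C : ℝ)⁻¹ ^ 2 +
        if i = j then (if c = d then (Fintype.card C : ℝ)⁻¹ else 0) else 0) := by
    intro i
    rw [Finset.sum_comm]
    refine Finset.sum_le_sum fun j _ => ?_
    by_cases hij : i = j
    · subst hij
      by_cases hcd : c = d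
      · subst hcd
        have : ∀ u : Fin N → C, ((if u i = c then (1:ℝ) else 0) * (if u i = c then 1 else 0))
          = if u i = c then 1 else 0 := by intro u; split_ifs <;> simp
        simp only [this, avg_one]
        simp
      · have : ∀ u : Fin N → C, ((if u i = c then (1:ℝ) else 0) * (if u i = d then 1 else 0))
          = 0 := by
          intro u; split_ifs with h h' <;> simp
          exact hcd (h.symm.trans h')
        simp only [this]
        simp [hcd]
    · rw [avg_two i j hij]
      simp [hij]
  refine (Finset.sum_le_sum fun i _ => h1 i).trans (le_of_eq ?_)
  simp only [Finset.sum_add_distrib]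
  by_cases hcd : c = d
  · simp [hcd]; ring
  · simp [hcd]; ring

lemma bad_count {C : Type} [Fintype C] [DecidableEq C] [Nonempty C] (N k : ℕ) (hN : 0 < N)
    (hNM : N ≤ Fintype.card C) (Bad : Finset (Fin k → Fin N → C))
    (hBad : ∀ f ∈ Bad, ∀ c, ∃ a, ∀ i, f a i ≠ c) :
    (Bad.card : ℝ) * (((Fintype.card C : ℝ)⁻¹) ^ N) ^ k
      ≤ 2 ^ k * (Fintype.card C : ℝ)⁻¹ * ((Fintype.card C : ℝ) / N) ^ k := by
  have hM : (0:ℝ) < (Fintype.card C : ℝ) := by exact_mod_cast Fintype.card_pos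
  have hNM' : (N:ℝ) ≤ Fintype.card C := by exact_mod_cast hNM
  have hN' : (0:ℝ) < N := by exact_mod_cast hN
  have ac := fun c : C => avg_cnt (N := N) c
  have ac2 := fun c d : C => avg_cnt2 (N := N) c d
  set q := (Fintype.card C : ℝ)⁻¹ with hq
  have hq0 : 0 < q := by positivity
  set X : (Fin k → Fin N → C) → ℝ := fun f => ∑ c, ∏ a, cnt (f a) c with hX
  have hprod : ∀ h : (Fin N → C) → ℝ, ∑ f : Fin k → Fin N → C, (q ^ N) ^ k * ∏ a, h (f a)
      = (∑ u, q ^ N * h u) ^ k := by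
    intro h
    rw [Fintype.sum_pow]
    refine Finset.sum_congr rfl fun f _ => ?_
    rw [Finset.prod_mul_distrib]; simp
  have hone : ∑ f : Fin k → Fin N → C, (q ^ N) ^ k = 1 := by
    simp [hq]
  set m := (Fintype.card C : ℝ) * (N * q) ^ k with hm
  have hm0 : 0 < m := by positivity
  have hEX : ∑ f, (q ^ N) ^ k * X f = m := by
    simp only [hX, Finset.mul_sum]
    rw [Finset.sum_comm]
    have := fun c : C => hprod (fun u => cnt u c)
    simp only [this, ac]
    simp [hm]
  have hEX2 : ∑ f, (q ^ N) ^ k * X f ^ 2 ≤ m ^ 2 + Fintype.card C * (2 * (N * q)) ^ k := by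
    have h1 : ∀ f, (q ^ N) ^ k * X f ^ 2
        = ∑ c, ∑ d, (q ^ N) ^ k * ∏ a, (cnt (f a) c * cnt (f a) d) := by
      intro f
      simp only [hX]
      rw [sq, Finset.sum_mul_sum]
      simp only [Finset.mul_sum, Finset.prod_mul_distrib]
    rw [Finset.sum_congr rfl (fun f _ => h1 f), Finset.sum_comm]
    have h2 : ∀ c : C, ∑ f : Fin k → Fin N → C, ∑ d, (q ^ N) ^ k *
        ∏ a, (cnt (f a) c * cnt (f a) d) ≤
        ∑ d, ((N * q) ^ (2 * k) + if c = d then (2 * (N * q)) ^ k else 0) := by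
      intro c
      rw [Finset.sum_comm]
      refine Finset.sum_le_sum fun d _ => ?_
      rw [hprod (fun u => cnt u c * cnt u d)]
      have hnn : 0 ≤ ∑ u : Fin N → C, q ^ N * (cnt u c * cnt u d) := by
        refine Finset.sum_nonneg fun u _ => ?_
        have : ∀ c, 0 ≤ cnt u c := fun c => Finset.sum_nonneg fun i _ => by split_ifs <;> simp
        have := this c
        have := ‹∀ c, 0 ≤ cnt u c› d
        positivity
      refine (pow_le_pow_left₀ hnn (ac2 c d) k).trans ?_
      by_cases hcd : c = d
      · simp only [hcd, if_true]
        have hle : (N * q) ≤ 1 := by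
          rw [hq, ← div_eq_mul_inv, div_le_one hM]; exact hNM'
        have : ((N * q) ^ 2 + N * q) ^ k ≤ (2 * (N * q)) ^ k := by
          apply pow_le_pow_left₀ (by positivity)
          nlinarith [mul_pos hN' hq0]
        have h3 : 0 ≤ (N * q) ^ (2 * k) := by positivity
        linarith
      · simp [hcd, pow_mul]
    refine (Finset.sum_le_sum fun c _ => h2 c).trans (le_of_eq ?_)
    simp only [Finset.sum_add_distrib]
    simp [hm]
    ring
  have hXbad : ∀ f ∈ Bad, X f = 0 := by
    intro f hf
    refine Finset.sum_eq_zero fun c _ => ?_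
    obtain ⟨a, ha⟩ := hBad f hf c
    refine Finset.prod_eq_zero (Finset.mem_univ a) ?_
    simp [cnt, ha]
  have hcheb : (Bad.card : ℝ) * (q ^ N) ^ k * m ^ 2 ≤ Fintype.card C * (2 * (N * q)) ^ k := by
    calc (Bad.card : ℝ) * (q ^ N) ^ k * m ^ 2
        = ∑ f ∈ Bad, (q ^ N) ^ k * (X f - m) ^ 2 := by
          rw [Finset.sum_congr rfl (fun f hf => by rw [hXbad f hf])]
          simp; ring
      _ ≤ ∑ f, (q ^ N) ^ k * (X f - m) ^ 2 :=
          Finset.sum_le_sum_of_subset_of_nonneg (Finset.subset_univ _)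
            (fun f _ _ => by positivity)
      _ = ∑ f, (q ^ N) ^ k * X f ^ 2 - 2 * m * ∑ f, (q ^ N) ^ k * X f
          + m ^ 2 * ∑ f : Fin k → Fin N → C, (q ^ N) ^ k := by
          rw [Finset.mul_sum, Finset.mul_sum, ← Finset.sum_sub_distrib, ← Finset.sum_add_distrib]
          refine Finset.sum_congr rfl fun f _ => by ring
      _ ≤ _ := by rw [hEX, hone]; nlinarith
  have : (Bad.card : ℝ) * (q ^ N) ^ k ≤ Fintype.card C * (2 * (N * q)) ^ k / m ^ 2 := by
    rw [le_div_iff₀ (by positivity)]; exact hcheb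
  refine this.trans (le_of_eq ?_)
  rw [hm, hq]
  simp only [mul_pow, div_pow, inv_pow]
  field_simp

lemma box_eq (a b : Fin 2 → ℝ) : {x : EuclideanSpace ℝ (Fin 2) | ∀ i, x i ∈ Set.Icc (a i) (b i)}
    = (@WithLp.ofLp 2 (Fin 2 → ℝ)) ⁻¹' Set.Icc a b := by
  ext x
  simp only [Set.mem_ofPred_eq, Set.mem_preimage, Set.mem_Icc, Pi.le_def]
  exact ⟨fun h => ⟨fun i => (h i).1, fun i => (h i).2⟩, fun h i => ⟨h.1 i, h.2 i⟩⟩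

lemma box_meas (a b : Fin 2 → ℝ) :
    MeasurableSet {x : EuclideanSpace ℝ (Fin 2) | ∀ i, x i ∈ Set.Icc (a i) (b i)} := by
  rw [box_eq]
  exact (PiLp.volume_preserving_ofLp (Fin 2)).measurable measurableSet_Icc

lemma box_vol (a b : Fin 2 → ℝ) :
    volume {x : EuclideanSpace ℝ (Fin 2) | ∀ i, x i ∈ Set.Icc (a i) (b i)}
      = ∏ i, ENNReal.ofReal (b i - a i) := by
  rw [box_eq, (PiLp.volume_preserving_ofLp (Fin 2)).measure_preimage
    measurableSet_Icc.nullMeasurableSet, Real.volume_Icc_pi]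

instance sq_prob : IsProbabilityMeasure
    ((volume : Measure (EuclideanSpace ℝ (Fin 2))).restrict unitSquare) := by
  constructor
  rw [Measure.restrict_apply_univ]
  have := box_vol (fun _ => 0) (fun _ => 1)
  refine this.trans ?_
  simp

instance sqM_prob (n : ℕ) : IsProbabilityMeasure (sqMeasure n) := by
  unfold sqMeasure; infer_instance

def cell (m : ℕ) (c : Fin 2 → Fin m) : Set (EuclideanSpace ℝ (Fin 2)) :=
  {x | ∀ i, x i ∈ Set.Icc ((c i : ℝ) / m) (((c i : ℝ) + 1) / m)}

lemma cell_meas (m : ℕ) (c : Fin 2 → Fin m) : MeasurableSet (cell m c) := box_meas _ _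

lemma cell_vol (m : ℕ) (c : Fin 2 → Fin m) :
    (volume.restrict unitSquare) (cell m c) ≤ ENNReal.ofReal (((m : ℝ) ^ 2)⁻¹) := by
  refine (Measure.restrict_apply_le _ _).trans ?_
  unfold cell
  rw [box_vol (fun i => (c i : ℝ) / m) (fun i => ((c i : ℝ) + 1) / m)]
  have : ∀ i, ((c i : ℝ) + 1) / m - (c i : ℝ) / m = (m : ℝ)⁻¹ := by intro i; ring
  simp only [this]
  rw [Finset.prod_const, ← ENNReal.ofReal_pow (by positivity)]
  simp

lemma cell_cover (m : ℕ) (hm : 0 < m) (x : EuclideanSpace ℝ (Fin 2)) (hx : x ∈ unitSquare) :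
    ∃ c, x ∈ cell m c := by
  have hm' : (0 : ℝ) < m := by exact_mod_cast hm
  have : ∀ i, ∃ c : Fin m, x i ∈ Set.Icc ((c : ℝ) / m) (((c : ℝ) + 1) / m) := by
    intro i
    obtain ⟨h0, h1⟩ := hx i
    by_cases h : x i = 1
    · refine ⟨⟨m - 1, by omega⟩, ?_⟩
      have : ((m - 1 : ℕ) : ℝ) = m - 1 := by push_cast [Nat.one_le_iff_ne_zero.2 hm.ne']; rfl
      simp only [this, h, Set.mem_Icc]
      constructor
      · rw [div_le_one hm']; linarith
      · rw [le_div_iff₀ hm']; linarith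
    · have h2 : x i < 1 := lt_of_le_of_ne h1 h
      have h3 : 0 ≤ x i * m := by positivity
      refine ⟨⟨⌊x i * m⌋₊, ?_⟩, ?_, ?_⟩
      · rw [Nat.floor_lt h3]; nlinarith
      · rw [div_le_iff₀ hm']; exact Nat.floor_le h3
      · rw [le_div_iff₀ hm']; exact (Nat.lt_floor_add_one _).le
  choose c hc using this
  exact ⟨c, hc⟩

lemma cell_dist (m : ℕ) (hm : 0 < m) (r : ℝ) (hr0 : 0 ≤ r) (hr : 2 ≤ (r * m) ^ 2)
    (c : Fin 2 → Fin m) (x y : EuclideanSpace ℝ (Fin 2)) (hx : x ∈ cell m c) (hy : y ∈ cell m c) :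
    dist x y ≤ r := by
  have hm' : (0 : ℝ) < m := by exact_mod_cast hm
  rw [EuclideanSpace.dist_eq]
  apply Real.sqrt_le_iff.2 ⟨hr0, ?_⟩
  have key : ∀ i, dist (x i) (y i) ^ 2 ≤ ((m : ℝ)⁻¹) ^ 2 := by
    intro i
    have h := Real.dist_le_of_mem_Icc (hx i) (hy i)
    have e : ((c i : ℝ) + 1) / m - (c i : ℝ) / m = (m : ℝ)⁻¹ := by ring
    rw [e] at h
    exact pow_le_pow_left₀ dist_nonneg h 2
  rw [Fin.sum_univ_two]
  have h2 : 2 * ((m : ℝ)⁻¹) ^ 2 ≤ r ^ 2 := by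
    rw [inv_pow, ← div_eq_mul_inv, div_le_iff₀ (by positivity)]
    nlinarith
  linarith [key 0, key 1]

lemma prod_event (n : ℕ) {P : Type} [Fintype P] (g : P → Fin n) (hg : g.Injective)
    (A : P → Set (EuclideanSpace ℝ (Fin 2))) (hA : ∀ p, MeasurableSet (A p)) :
    sqMeasure n {x | ∀ p, x (g p) ∈ A p} = ∏ p, (volume.restrict unitSquare) (A p) := by
  have h := ProbabilityTheory.iIndepFun_pi (ι := Fin n)
    (μ := fun _ => (volume : Measure (EuclideanSpace ℝ (Fin 2))).restrict unitSquare)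
    (X := fun _ => id) (fun _ => aemeasurable_id)
  have h2 := (h.precomp hg).measure_inter_preimage_eq_mul Finset.univ (sets := A)
    (fun i _ => hA i)
  have e : {x : Fin n → EuclideanSpace ℝ (Fin 2) | ∀ p, x (g p) ∈ A p} =
    ⋂ i ∈ (Finset.univ : Finset P), (fun ω : Fin n → EuclideanSpace ℝ (Fin 2) =>
      id (ω (g i))) ⁻¹' A i := by
    ext x; simp
  unfold sqMeasure
  rw [e, h2]
  refine Finset.prod_congr rfl fun p _ => ?_
  exact (measurePreserving_eval (fun _ : Fin n =>
    (volume : Measure (EuclideanSpace ℝ (Fin 2))).restrict unitSquare) (g p)).measure_preimage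
      (hA p).nullMeasurableSet

lemma prob_bound (n m k N : ℕ) (r : ℝ) (hm : 0 < m) (hr0 : 0 ≤ r) (hr : 2 ≤ (r * m) ^ 2)
    (hk : 0 < k) (hN : 0 < N) (hNM : N ≤ m ^ 2) (hkN : k * N ≤ n) :
    sqMeasure n {x | ∃ S : Finset (Fin n), S.card = k ∧
          ((geomGraph n r x).induce (S : Set (Fin n))).Connected}ᶜ
      ≤ ENNReal.ofReal (2 ^ k * ((m : ℝ) ^ 2)⁻¹ * ((m : ℝ) ^ 2 / N) ^ k) := by
  classical
  have : Nonempty (Fin m) := ⟨⟨0, hm⟩⟩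
  set C := Fin 2 → Fin m with hC
  have hcard : Fintype.card C = m ^ 2 := by simp [hC]
  set g : Fin k × Fin N → Fin n := fun p => Fin.castLE hkN (finProdFinEquiv p) with hgdef
  have hg : g.Injective := (Fin.castLE_injective hkN).comp finProdFinEquiv.injective
  set Bad : Finset (Fin k → Fin N → C) :=
    Finset.univ.filter (fun f => ∀ c, ∃ a, ∀ i, f a i ≠ c) with hBad
  have hb := bad_count N k hN (by rw [hcard]; exact hNM) Bad (by simp [hBad])
  rw [hcard] at hb
  push_cast at hb
  have hae : ∀ᵐ x ∂(sqMeasure n), ∀ j, x j ∈ unitSquare := by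
    rw [ae_all_iff]
    intro j
    have : ∀ᵐ y ∂((volume : Measure (EuclideanSpace ℝ (Fin 2))).restrict unitSquare),
        y ∈ unitSquare :=
      ae_restrict_mem (box_meas (fun _ => 0) (fun _ => 1))
    exact (Measure.quasiMeasurePreserving_eval (fun _ : Fin n =>
      (volume : Measure (EuclideanSpace ℝ (Fin 2))).restrict unitSquare) j).ae this
  have hsub : ∀ᵐ x ∂(sqMeasure n), x ∈ {x | ∃ S : Finset (Fin n), S.card = k ∧
          ((geomGraph n r x).induce (S : Set (Fin n))).Connected}ᶜ →
      x ∈ ⋃ f ∈ Bad, {x : Fin n → EuclideanSpace ℝ (Fin 2) |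
        ∀ p : Fin k × Fin N, x (g p) ∈ cell m (f p.1 p.2)} := by
    filter_upwards [hae] with x hx hnot
    choose f hf using fun p : Fin k × Fin N => cell_cover m hm (x (g p)) (hx (g p))
    simp only [Set.mem_iUnion]
    refine ⟨fun a i => f (a, i), ?_, fun p => hf p⟩
    simp only [hBad, Finset.mem_filter, Finset.mem_univ, true_and]
    by_contra hcon
    push Not at hcon
    obtain ⟨c, hc⟩ := hcon
    choose t ht using hc
    apply hnot
    have hinj : Function.Injective (fun a : Fin k => g (a, t a)) := by
      intro a b hab
      exact congrArg Prod.fst (hg hab)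
    refine ⟨Finset.univ.image (fun a => g (a, t a)), ?_, ?_⟩
    · rw [Finset.card_image_of_injective _ hinj]; simp
    · have hmem : ∀ v ∈ (Finset.univ.image (fun a => g (a, t a))), x v ∈ cell m c := by
        intro v hv
        simp only [Finset.mem_image, Finset.mem_univ, true_and] at hv
        obtain ⟨a, rfl⟩ := hv
        have := hf (a, t a)
        rw [ht a] at this
        exact this
      have : Nonempty ((Finset.univ.image (fun a => g (a, t a)) : Finset (Fin n)) : Set (Fin n)) :=
        ⟨⟨g (⟨0, hk⟩, t ⟨0, hk⟩), by simp⟩⟩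
      refine SimpleGraph.Connected.mk fun u v => ?_
      by_cases huv : u = v
      · rw [huv]
      · apply SimpleGraph.Adj.reachable
        refine ⟨fun h => huv (Subtype.ext h), ?_⟩
        exact cell_dist m hm r hr0 hr c _ _ (hmem _ u.2) (hmem _ v.2)
  refine (measure_mono_ae hsub).trans ?_
  refine (measure_biUnion_finset_le _ _).trans ?_
  have hone : ∀ f ∈ Bad, sqMeasure n {x : Fin n → EuclideanSpace ℝ (Fin 2) |
        ∀ p : Fin k × Fin N, x (g p) ∈ cell m (f p.1 p.2)}
        ≤ ENNReal.ofReal (((((m : ℝ) ^ 2)⁻¹) ^ N) ^ k) := by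
    intro f _
    rw [prod_event n g hg (fun p => cell m (f p.1 p.2)) (fun p => cell_meas m _)]
    refine (Finset.prod_le_prod' (fun p _ => cell_vol m (f p.1 p.2))).trans ?_
    rw [Finset.prod_const, ← ENNReal.ofReal_pow (by positivity)]
    simp only [Finset.card_univ, Fintype.card_prod, Fintype.card_fin]
    rw [← pow_mul, mul_comm N k]
  refine (Finset.sum_le_sum hone).trans ?_
  rw [Finset.sum_const, nsmul_eq_mul, ← ENNReal.ofReal_natCast,
    ← ENNReal.ofReal_mul (by positivity)]
  exact ENNReal.ofReal_le_ofReal hb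

lemma final_bound (k : ℕ) (hk : 2 ≤ k) (r : ℕ → ℝ)
    (hrpos : ∀ n, 0 < r n)
    (hr : Tendsto (fun n : ℕ => r n * (n : ℝ) ^ ((k : ℝ) / (2 * (k : ℝ) - 2)))
      atTop atTop) (m : ℕ → ℕ) (hm : m = fun n => ⌈√2 / r n⌉₊ + ⌈√(n : ℝ)⌉₊) :
    Tendsto (fun n : ℕ => (2 : ℝ) ^ k * ((m n : ℝ) ^ 2)⁻¹ * ((m n : ℝ) ^ 2 / (n / k : ℕ)) ^ k)
      atTop (nhds 0) := by
  have hk' : (2 : ℝ) ≤ k := by exact_mod_cast hk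
  set α := (k : ℝ) / (2 * (k : ℝ) - 2) with hα
  have hα2 : 1 / 2 < α := by
    rw [hα, div_lt_div_iff₀ (by norm_num) (by linarith)]; linarith
  have hα0 : 0 < α := by linarith
  -- m n / n^α → 0
  have h1 : Tendsto (fun n : ℕ => √2 * (r n * (n : ℝ) ^ α)⁻¹ + (n : ℝ) ^ (-(α - 1 / 2))
      + 2 * (n : ℝ) ^ (-α)) atTop (nhds 0) := by
    have a := (tendsto_inv_atTop_zero.comp hr).const_mul (√2)
    have b := (tendsto_rpow_neg_atTop (y := α - 1 / 2) (by linarith)).comp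
      (tendsto_natCast_atTop_atTop (R := ℝ))
    have c := ((tendsto_rpow_neg_atTop hα0).comp
      (tendsto_natCast_atTop_atTop (R := ℝ))).const_mul 2
    simpa using (a.add b).add c
  have h2 : Tendsto (fun n : ℕ => (m n : ℝ) * (n : ℝ) ^ (-α)) atTop (nhds 0) := by
    refine squeeze_zero' (Eventually.of_forall fun n => by positivity) ?_ h1
    filter_upwards [eventually_gt_atTop 0] with n hn
    have hn' : (0 : ℝ) < n := by exact_mod_cast hn
    have hrn := hrpos n
    have ha : (⌈√2 / r n⌉₊ : ℝ) ≤ √2 / r n + 1 := (Nat.ceil_lt_add_one (by positivity)).le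
    have hb : (⌈√(n : ℝ)⌉₊ : ℝ) ≤ √n + 1 := (Nat.ceil_lt_add_one (by positivity)).le
    have hm1 : (m n : ℝ) ≤ √2 / r n + √n + 2 := by rw [hm]; push_cast; linarith
    have e1 : (n : ℝ) ^ (-α) = ((n : ℝ) ^ α)⁻¹ := Real.rpow_neg hn'.le _
    have e2 : (n : ℝ) ^ (-(α - 1 / 2)) = √n * (n : ℝ) ^ (-α) := by
      rw [Real.sqrt_eq_rpow, ← Real.rpow_add hn']; congr 1; ring
    have hp : 0 ≤ (n : ℝ) ^ (-α) := by positivity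
    calc (m n : ℝ) * (n : ℝ) ^ (-α) ≤ (√2 / r n + √n + 2) * (n : ℝ) ^ (-α) := by gcongr
      _ = _ := by rw [e2, e1, mul_inv]; ring
  have h3 : Tendsto (fun n : ℕ => (4 * k : ℝ) ^ k * ((m n : ℝ) * (n : ℝ) ^ (-α)) ^ (2 * k - 2))
      atTop (nhds 0) := by
    have := (h2.pow (2 * k - 2)).const_mul ((4 * k : ℝ) ^ k)
    rwa [zero_pow (by omega), mul_zero] at this
  refine squeeze_zero' (Eventually.of_forall fun n => by positivity) ?_ h3
  filter_upwards [eventually_ge_atTop k] with n hn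
  have hnpos : 0 < n := by omega
  have hn' : (0 : ℝ) < n := by exact_mod_cast hnpos
  have hm0 : 0 < m n := by
    rw [hm]
    have : 0 < ⌈√2 / r n⌉₊ := Nat.ceil_pos.2 (div_pos (by positivity) (hrpos n))
    simp only; omega
  have hm0' : (0 : ℝ) < m n := by exact_mod_cast hm0
  have hN1 : 1 ≤ n / k := (Nat.one_le_div_iff (by omega)).2 hn
  have hN : n ≤ 2 * k * (n / k) := by
    have h1 := Nat.div_add_mod n k
    have h2 := Nat.mod_lt n (show k > 0 by omega)
    have h3 : k * 1 ≤ k * (n / k) := Nat.mul_le_mul_left k hN1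
    nlinarith
  have hN' : (n : ℝ) ≤ 2 * k * (n / k : ℕ) := by exact_mod_cast hN
  have hNpos : (0 : ℝ) < (n / k : ℕ) := by exact_mod_cast hN1
  have hdiv : (m n : ℝ) ^ 2 / (n / k : ℕ) ≤ 2 * k * ((m n : ℝ) ^ 2 / n) := by
    rw [div_le_iff₀ hNpos]
    have : 2 * k * ((m n : ℝ) ^ 2 / n) * (n / k : ℕ)
      = (m n : ℝ) ^ 2 * ((2 * k * (n / k : ℕ)) / n) := by ring
    rw [this]
    have : 1 ≤ (2 * k * ((n / k : ℕ) : ℝ)) / n := by rw [le_div_iff₀ hn']; linarith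
    nlinarith [sq_nonneg (m n : ℝ)]
  have e3 : ((n : ℝ) ^ (-α)) ^ (2 * k - 2) = ((n : ℝ) ^ k)⁻¹ := by
    rw [← Real.rpow_natCast, ← Real.rpow_mul hn'.le, ← Real.rpow_natCast, ← Real.rpow_neg hn'.le]
    congr 1
    have : ((2 * k - 2 : ℕ) : ℝ) = 2 * k - 2 := by
      rw [Nat.cast_sub (by omega)]; push_cast; rfl
    rw [this, hα]
    have : (2 * (k : ℝ) - 2) ≠ 0 := by linarith
    rw [neg_mul, div_mul_cancel₀ _ this]
  have e4 : (m n : ℝ) ^ (2 * k) = (m n : ℝ) ^ (2 * k - 2) * (m n : ℝ) ^ 2 := by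
    rw [← pow_add]; congr 1; omega
  calc (2 : ℝ) ^ k * ((m n : ℝ) ^ 2)⁻¹ * ((m n : ℝ) ^ 2 / (n / k : ℕ)) ^ k
      ≤ (2 : ℝ) ^ k * ((m n : ℝ) ^ 2)⁻¹ * (2 * k * ((m n : ℝ) ^ 2 / n)) ^ k := by gcongr
    _ = (4 * k : ℝ) ^ k * (((m n : ℝ) ^ 2)⁻¹ * (m n : ℝ) ^ (2 * k) * ((n : ℝ) ^ k)⁻¹) := by
        rw [show (4 : ℝ) * k = 2 * (2 * k) by ring, mul_pow 2 (2 * (k : ℝ)),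
          mul_pow (2 * (k : ℝ)), div_pow, ← pow_mul]; ring
    _ = _ := by
        rw [mul_pow (m n : ℝ), e3, e4]; field_simp

theorem connected_subgraph_supercritical (k : ℕ) (hk : 2 ≤ k) (r : ℕ → ℝ)
    (hrpos : ∀ n, 0 < r n)
    (hr : Tendsto (fun n : ℕ => r n * (n : ℝ) ^ ((k : ℝ) / (2 * (k : ℝ) - 2)))
      atTop atTop) :
    Tendsto
      (fun n : ℕ => sqMeasure n
        {x | ∃ S : Finset (Fin n), S.card = k ∧
          ((geomGraph n (r n) x).induce (S : Set (Fin n))).Connected})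
      atTop (nhds 1) := by
  have hf := final_bound k hk r hrpos hr _ rfl
  have hf2 := ENNReal.tendsto_ofReal hf
  rw [ENNReal.ofReal_zero] at hf2
  have hf3 := ENNReal.Tendsto.sub (tendsto_const_nhds (x := (1 : ENNReal))) hf2
    (Or.inl ENNReal.one_ne_top)
  rw [tsub_zero] at hf3
  refine tendsto_of_tendsto_of_tendsto_of_le_of_le' hf3 tendsto_const_nhds ?_
    (Eventually.of_forall fun n => prob_le_one)
  filter_upwards [eventually_ge_atTop k] with n hn
  have hrn := hrpos n
  set m := ⌈√2 / r n⌉₊ + ⌈√(n : ℝ)⌉₊ with hm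
  have c1 : √2 / r n ≤ m := by
    rw [hm]; push_cast
    linarith [Nat.le_ceil (√2 / r n), (Nat.cast_nonneg ⌈√(n : ℝ)⌉₊ : (0 : ℝ) ≤ _)]
  have c2 : √(n : ℝ) ≤ m := by
    rw [hm]; push_cast
    linarith [Nat.le_ceil (√(n : ℝ)), (Nat.cast_nonneg ⌈√2 / r n⌉₊ : (0 : ℝ) ≤ _)]
  have hm0 : 0 < m := by
    have : 0 < √2 / r n := by positivity
    exact_mod_cast this.trans_le c1
  have hr2 : 2 ≤ (r n * m) ^ 2 := by
    rw [div_le_iff₀ hrn] at c1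
    calc (2 : ℝ) = √2 ^ 2 := by simp
      _ ≤ _ := by apply pow_le_pow_left₀ (by positivity); linarith
  have hnm : n ≤ m ^ 2 := by
    have : (n : ℝ) ≤ (m : ℝ) ^ 2 := by
      calc (n : ℝ) = √(n : ℝ) ^ 2 := by simp
        _ ≤ _ := pow_le_pow_left₀ (by positivity) c2 2
    exact_mod_cast this
  have hpb := prob_bound n m k (n / k) (r n) hm0 hrn.le hr2 (by omega)
    (Nat.div_pos hn (by omega)) ((Nat.div_le_self n k).trans hnm) (Nat.mul_div_le n k)
  rw [tsub_le_iff_right]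
  set E := {x : Fin n → EuclideanSpace ℝ (Fin 2) | ∃ S : Finset (Fin n), S.card = k ∧
          ((geomGraph n (r n) x).induce (S : Set (Fin n))).Connected} with hE
  calc (1 : ENNReal) = sqMeasure n Set.univ := measure_univ.symm
    _ = sqMeasure n (E ∪ Eᶜ) := by rw [Set.union_compl_self]
    _ ≤ sqMeasure n E + sqMeasure n Eᶜ := measure_union_le _ _
    _ ≤ _ := by
      gcongr
end
end

section
/- Let k ≥ 2 be a fixed integer, and let r : ℕ → ℝ be a positive function with r(n)·n^{k/(2k−2)} → 0 as n → ∞. Then the probability that the random geometric graph G(n, r(n)) contains a clique of size k (k vertices that are pairwise adjacent) tends to 0 as n → ∞. -/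
open MeasureTheory Filter

noncomputable section

lemma vol_unitSquare : (volume : Measure (EuclideanSpace ℝ (Fin 2))) unitSquare = 1 := by
  have hs : unitSquare = (MeasurableEquiv.toLp 2 (Fin 2 → ℝ)).symm ⁻¹'
      (Set.pi Set.univ fun _ => Set.Icc (0:ℝ) 1) := by
    ext x
    simp [unitSquare, Pi.le_def, Fin.forall_fin_two]
    tauto
  have h2 := (EuclideanSpace.volume_preserving_symm_measurableEquiv_toLp (Fin 2)).measure_preimage_equiv
    (Set.pi Set.univ fun _ => Set.Icc (0:ℝ) 1)
  rw [hs, h2, volume_pi, Measure.pi_pi]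
  simp

instance instProbSq : IsProbabilityMeasure
    ((volume : Measure (EuclideanSpace ℝ (Fin 2))).restrict unitSquare) :=
  ⟨by simp [vol_unitSquare]⟩

lemma ball_bound (a : EuclideanSpace ℝ (Fin 2)) (r : ℝ) (hr : 0 < r) :
    (volume.restrict unitSquare) (Metric.closedBall a r) ≤ ENNReal.ofReal (Real.pi * r ^ 2) := by
  refine (Measure.restrict_apply_le _ _).trans ?_
  rw [EuclideanSpace.volume_closedBall_fin_two]
  rw [mul_comm, ENNReal.ofReal_mul Real.pi_pos.le, ENNReal.ofReal_pow hr.le]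

lemma star_bound (n k : ℕ) (r : ℝ) (hr : 0 < r) (S : Finset (Fin n)) (hS : S.card = k)
    (i₀ : Fin n) (hi : i₀ ∈ S) :
    sqMeasure n {x | ∀ i ∈ S, dist (x i) (x i₀) ≤ r} ≤
      ENNReal.ofReal (Real.pi * r ^ 2) ^ (k - 1) := by
  classical
  obtain _ | m := n
  · exact i₀.elim0
  set μ := (volume : Measure (EuclideanSpace ℝ (Fin 2))).restrict unitSquare with hμ
  have hmp := measurePreserving_piFinSuccAbove (fun _ : Fin (m+1) => μ) i₀
  let T : Set (EuclideanSpace ℝ (Fin 2) × (Fin m → EuclideanSpace ℝ (Fin 2))) :=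
    {p | ∀ j, i₀.succAbove j ∈ S → dist (p.2 j) p.1 ≤ r}
  have hT : MeasurableSet T := by
    have : T = ⋂ j, ⋂ (_ : i₀.succAbove j ∈ S), {p | dist (p.2 j) p.1 ≤ r} := by
      ext p; simp [T]
    rw [this]
    refine MeasurableSet.iInter fun j => MeasurableSet.iInter fun _ => ?_
    exact measurableSet_le (by fun_prop) measurable_const
  have hcard : (Finset.univ.filter fun j : Fin m => i₀.succAbove j ∈ S).card = k - 1 := by
    have h1 : ∑ i : Fin (m+1), (if i ∈ S then 1 else 0) = k := by simp [hS]
    rw [Fin.sum_univ_succAbove _ i₀] at h1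
    simp only [hi, if_true, Finset.sum_boole, Nat.cast_id] at h1
    omega
  calc sqMeasure (m+1) {x | ∀ i ∈ S, dist (x i) (x i₀) ≤ r}
      ≤ sqMeasure (m+1) ((MeasurableEquiv.piFinSuccAbove (fun _ => EuclideanSpace ℝ (Fin 2)) i₀) ⁻¹' T) := by
        apply measure_mono
        intro x hx j hj
        exact hx _ hj
    _ = (μ.prod (Measure.pi fun _ => μ)) T := hmp.measure_preimage hT.nullMeasurableSet
    _ = ∫⁻ a, (Measure.pi fun _ => μ) (Prod.mk a ⁻¹' T) ∂μ := Measure.prod_apply hT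
    _ ≤ ∫⁻ a, ENNReal.ofReal (Real.pi * r ^ 2) ^ (k - 1) ∂μ := by
        apply lintegral_mono
        intro a
        have : Prod.mk a ⁻¹' T = Set.pi Set.univ
            (fun j => if i₀.succAbove j ∈ S then Metric.closedBall a r else Set.univ) := by
          ext y
          simp only [T, Set.mem_preimage, Set.mem_setOf_eq, Set.mem_pi, Set.mem_univ, true_imp_iff]
          refine forall_congr' fun j => ?_
          split_ifs with h <;> simp [h]
        simp only [this]
        rw [Measure.pi_pi]
        calc _ ≤ ∏ j : Fin m, (if i₀.succAbove j ∈ S then ENNReal.ofReal (Real.pi * r ^ 2) else 1) := by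
              apply Finset.prod_le_prod' 
              intro j _
              split_ifs
              · exact ball_bound a r hr
              · exact prob_le_one
          _ = _ := by
              rw [Finset.prod_ite]; simp [hcard]
    _ = _ := by simp [hμ, vol_unitSquare]

lemma union_bound (n k : ℕ) (hk : 2 ≤ k) (r : ℝ) (hr : 0 < r) :
    sqMeasure n {x | ∃ S : Finset (Fin n), (geomGraph n r x).IsNClique k S} ≤
      ENNReal.ofReal ((n:ℝ) ^ k * (Real.pi * r ^ 2) ^ (k - 1)) := by
  classical
  calc _ ≤ sqMeasure n (⋃ S ∈ Finset.powersetCard k (Finset.univ : Finset (Fin n)),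
          {x | (geomGraph n r x).IsNClique k S}) := by
        apply measure_mono
        rintro x ⟨S, hS⟩
        simp only [Set.mem_iUnion, Finset.mem_powersetCard]
        exact ⟨S, ⟨Finset.subset_univ _, hS.card_eq⟩, hS⟩
    _ ≤ ∑ S ∈ Finset.powersetCard k (Finset.univ : Finset (Fin n)),
          sqMeasure n {x | (geomGraph n r x).IsNClique k S} := measure_biUnion_finset_le _ _
    _ ≤ ∑ S ∈ Finset.powersetCard k (Finset.univ : Finset (Fin n)),
          ENNReal.ofReal (Real.pi * r ^ 2) ^ (k - 1) := by
        apply Finset.sum_le_sum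
        intro S hS
        have hc := (Finset.mem_powersetCard.1 hS).2
        obtain ⟨i₀, hi⟩ : S.Nonempty := Finset.card_pos.1 (by omega)
        refine le_trans (measure_mono ?_) (star_bound n k r hr S hc i₀ hi)
        intro x hx i hiS
        by_cases h : i = i₀
        · simp [h, hr.le]
        · exact (hx.isClique hiS hi h).2
    _ = (n.choose k : ENNReal) * ENNReal.ofReal (Real.pi * r ^ 2) ^ (k - 1) := by
        simp
    _ ≤ _ := by
        rw [ENNReal.ofReal_mul (p := (n:ℝ) ^ k) (by positivity), ENNReal.ofReal_pow (p := Real.pi * r ^ 2) (by positivity)]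
        gcongr
        rw [← Nat.cast_pow, ENNReal.ofReal_natCast]
        exact_mod_cast Nat.choose_le_pow n k

theorem clique_subcritical (k : ℕ) (hk : 2 ≤ k) (r : ℕ → ℝ)
    (hrpos : ∀ n, 0 < r n)
    (hr : Tendsto (fun n : ℕ => r n * (n : ℝ) ^ ((k : ℝ) / (2 * (k : ℝ) - 2)))
      atTop (nhds 0)) :
    Tendsto
      (fun n : ℕ => sqMeasure n
        {x | ∃ S : Finset (Fin n), (geomGraph n (r n) x).IsNClique k S})
      atTop (nhds 0) := by
  have hlim : Tendsto (fun n : ℕ => (n:ℝ) ^ k * (Real.pi * r n ^ 2) ^ (k - 1)) atTop (nhds 0) := by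
    have h1 := (hr.pow (2 * (k - 1))).const_mul (Real.pi ^ (k - 1))
    rw [zero_pow (by omega), mul_zero] at h1
    refine h1.congr fun n => ?_
    have h2 : ((n : ℝ) ^ ((k : ℝ) / (2 * (k : ℝ) - 2))) ^ (2 * (k - 1)) = (n:ℝ) ^ k := by
      rw [← Real.rpow_natCast, ← Real.rpow_mul (Nat.cast_nonneg n), ← Real.rpow_natCast]
      congr 1
      have hk' : (2:ℝ) ≤ k := by exact_mod_cast hk
      have : (2 * (k:ℝ) - 2) ≠ 0 := by linarith
      push_cast [Nat.cast_sub (show 1 ≤ k by omega)]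
      rw [div_mul_eq_mul_div, div_eq_iff this]
      ring
    rw [mul_pow, h2, mul_pow, pow_mul]
    ring
  have h3 := ENNReal.tendsto_ofReal hlim
  rw [ENNReal.ofReal_zero] at h3
  exact tendsto_of_tendsto_of_tendsto_of_le_of_le tendsto_const_nhds h3 (fun _ => zero_le)
    (fun n => union_bound n k hk (r n) (hrpos n))
end
end

section
/- Let c ≥ 36 be a constant and let r : ℕ → ℝ be a positive function satisfying r(n) ≥ √(c·ln n / n) for all n ≥ 2. Then the probability that the random geometric graph G(n, r(n)) has two crossing edges (i.e., is not plane) tends to 1 as n → ∞. -/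
open MeasureTheory Filter

noncomputable section

/-- Two segments `[a,b]` and `[c,d]` cross if they have a common point that is interior to
both segments, i.e. lies on each segment and is distinct from its endpoints. -/
def Crosses (a b c d : EuclideanSpace ℝ (Fin 2)) : Prop :=
  ∃ p, (p ∈ segment ℝ a b ∧ p ≠ a ∧ p ≠ b) ∧ (p ∈ segment ℝ c d ∧ p ≠ c ∧ p ≠ d)

/-- The (straight-line drawing of the) random geometric graph has two crossing edges. -/
def HasCrossing (n : ℕ) (r : ℝ) (x : Fin n → EuclideanSpace ℝ (Fin 2)) : Prop :=
  ∃ i j k l : Fin n, (geomGraph n r x).Adj i j ∧ (geomGraph n r x).Adj k l ∧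
    ({i, j} : Finset (Fin n)) ≠ {k, l} ∧ Crosses (x i) (x j) (x k) (x l)

abbrev E2 := EuclideanSpace ℝ (Fin 2)

/-- box with lower left corner (p,q), side h -/
def bx (p q h : ℝ) : Set E2 :=
  {x | x 0 ∈ Set.Icc p (p + h) ∧ x 1 ∈ Set.Icc q (q + h)}

lemma bx_eq (p q h : ℝ) : bx p q h =
    (MeasurableEquiv.toLp 2 (Fin 2 → ℝ)).symm ⁻¹' (Set.pi Set.univ
      (fun i => Set.Icc ((![p, q] : Fin 2 → ℝ) i) ((![p + h, q + h] : Fin 2 → ℝ) i))) := by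
  ext x
  simp [bx, Pi.le_def, Fin.forall_fin_two]
  tauto

lemma bx_meas (p q h : ℝ) : MeasurableSet (bx p q h) := by
  rw [bx_eq]
  exact (MeasurableEquiv.measurable _) (MeasurableSet.univ_pi fun i => measurableSet_Icc)

lemma bx_vol (p q h : ℝ) (hh : 0 ≤ h) : volume (bx p q h) = ENNReal.ofReal (h ^ 2) := by
  rw [bx_eq, (EuclideanSpace.volume_preserving_symm_measurableEquiv_toLp (Fin 2)).measure_preimage
    (MeasurableSet.univ_pi fun i => measurableSet_Icc).nullMeasurableSet]
  rw [volume_pi_pi]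
  simp [Fin.prod_univ_two, Real.volume_Icc, ENNReal.ofReal_pow hh, pow_two, ENNReal.ofReal_mul hh]

lemma sq_eq : unitSquare = bx 0 0 1 := by
  ext x; simp [unitSquare, bx, Fin.forall_fin_two]

instance : IsProbabilityMeasure (volume.restrict unitSquare : Measure E2) := by
  constructor
  rw [Measure.restrict_apply_univ, sq_eq, bx_vol _ _ _ zero_le_one]; simp

lemma miss (n : ℕ) (p q h : ℝ) (hp : 0 ≤ p) (hq : 0 ≤ q) (hh : 0 ≤ h) (hp1 : p + h ≤ 1)
    (hq1 : q + h ≤ 1) :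
    sqMeasure n {x | ∀ i, x i ∉ bx p q h} ≤ ENNReal.ofReal (Real.exp (-(n * h ^ 2))) := by
  have h1 : {x : Fin n → E2 | ∀ i, x i ∉ bx p q h} = Set.pi Set.univ (fun _ => (bx p q h)ᶜ) := by
    ext x; simp [Set.mem_pi]
  have hsub : bx p q h ⊆ unitSquare := by
    rw [sq_eq]
    rintro x ⟨⟨a, b⟩, c, d⟩
    refine ⟨⟨?_, ?_⟩, ?_, ?_⟩ <;> linarith
  have hh1 : h ≤ 1 := by linarith
  have h2 : (volume.restrict unitSquare : Measure E2) (bx p q h)ᶜ = ENNReal.ofReal (1 - h ^ 2) := by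
    rw [prob_compl_eq_one_sub (bx_meas _ _ _), Measure.restrict_apply (bx_meas _ _ _),
      Set.inter_eq_left.2 hsub, bx_vol _ _ _ hh, ENNReal.ofReal_sub _ (by positivity)]
    simp
  rw [h1, sqMeasure, Measure.pi_pi, h2]
  simp only [Finset.prod_const, Finset.card_univ, Fintype.card_fin]
  have h0 : 0 ≤ 1 - h ^ 2 := by nlinarith
  rw [← ENNReal.ofReal_pow h0]
  apply ENNReal.ofReal_le_ofReal
  calc (1 - h ^ 2) ^ n ≤ (Real.exp (-h ^ 2)) ^ n := by
        gcongr
        have := Real.add_one_le_exp (-h ^ 2); linarith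
    _ = _ := by rw [← Real.exp_nat_mul]; congr 1; ring

lemma dist_le' (a b : E2) (h : ℝ) (hh : 0 ≤ h) (h0 : |a 0 - b 0| ≤ 9 * h)
    (h1 : |a 1 - b 1| ≤ 9 * h) (hm : |a 0 - b 0| ≤ h ∨ |a 1 - b 1| ≤ h) :
    dist a b ≤ 10 * h := by
  rw [EuclideanSpace.dist_eq, Fin.sum_univ_two, Real.dist_eq, Real.dist_eq]
  apply Real.sqrt_le_iff.2 ⟨by positivity, ?_⟩
  have := abs_nonneg (a 0 - b 0)
  have := abs_nonneg (a 1 - b 1)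
  rcases hm with hm | hm <;> nlinarith

lemma cross_of (h : ℝ) (hh : 0 < h) (a b c d : E2) (ha : a ∈ bx 0 (4 * h) h)
    (hb : b ∈ bx (8 * h) (4 * h) h) (hc : c ∈ bx (4 * h) 0 h) (hd : d ∈ bx (4 * h) (8 * h) h) :
    Crosses a b c d := by
  obtain ⟨⟨a1, a2⟩, a3, a4⟩ := ha
  obtain ⟨⟨b1, b2⟩, b3, b4⟩ := hb
  obtain ⟨⟨c1, c2⟩, c3, c4⟩ := hc
  obtain ⟨⟨d1, d2⟩, d3, d4⟩ := hd
  have key : ∀ A B C D : ℝ, 3 * h ≤ A → 7 * h ≤ B → |C| ≤ 5 * h → |D| ≤ h → 0 < A * B - C * D := by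
    intro A B C D hA hB hC hD
    have e1 : C * D ≤ 5 * h * h := by
      calc C * D ≤ |C * D| := le_abs_self _
        _ = |C| * |D| := abs_mul _ _
        _ ≤ _ := by gcongr
    have e2 : 3 * h * (7 * h) ≤ A * B := by gcongr; linarith
    nlinarith
  have t1 := key (c 0 - a 0) (d 1 - c 1) (c 1 - a 1) (d 0 - c 0) (by linarith) (by linarith)
    (abs_le.2 ⟨by linarith, by linarith⟩) (abs_le.2 ⟨by linarith, by linarith⟩)
  have t2 := key (b 0 - c 0) (d 1 - c 1) (b 1 - c 1) (d 0 - c 0) (by linarith) (by linarith)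
    (abs_le.2 ⟨by linarith, by linarith⟩) (abs_le.2 ⟨by linarith, by linarith⟩)
  have u1 := key (a 1 - c 1) (b 0 - a 0) (a 0 - c 0) (b 1 - a 1) (by linarith) (by linarith)
    (abs_le.2 ⟨by linarith, by linarith⟩) (abs_le.2 ⟨by linarith, by linarith⟩)
  have u2 := key (d 1 - a 1) (b 0 - a 0) (d 0 - a 0) (b 1 - a 1) (by linarith) (by linarith)
    (abs_le.2 ⟨by linarith, by linarith⟩) (abs_le.2 ⟨by linarith, by linarith⟩)
  set D := (b 0 - a 0) * (d 1 - c 1) - (b 1 - a 1) * (d 0 - c 0) with hD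
  obtain ⟨t, ht⟩ : ∃ t, t = ((c 0 - a 0) * (d 1 - c 1) - (c 1 - a 1) * (d 0 - c 0)) / D := ⟨_, rfl⟩
  obtain ⟨u, hu⟩ : ∃ u, u = ((a 1 - c 1) * (b 0 - a 0) - (a 0 - c 0) * (b 1 - a 1)) / D := ⟨_, rfl⟩
  have hD0 : 0 < D := by rw [hD]; linarith
  have ht0 : 0 < t := by rw [ht]; positivity
  have hu0 : 0 < u := by rw [hu]; positivity
  have ht1 : t < 1 := by rw [ht, div_lt_one hD0]; linarith
  have hu1 : u < 1 := by rw [hu, div_lt_one hD0]; linarith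
  have ht' : t * D = ((c 0 - a 0) * (d 1 - c 1) - (c 1 - a 1) * (d 0 - c 0)) := by
    rw [ht]; field_simp
  have hu' : u * D = ((a 1 - c 1) * (b 0 - a 0) - (a 0 - c 0) * (b 1 - a 1)) := by
    rw [hu]; field_simp
  have e0 : (1 - t) * a 0 + t * b 0 = (1 - u) * c 0 + u * d 0 := by
    apply mul_right_cancel₀ hD0.ne'
    linear_combination (b 0 - a 0) * ht' - (d 0 - c 0) * hu' + (a 0 - c 0) * hD
  have e1 : (1 - t) * a 1 + t * b 1 = (1 - u) * c 1 + u * d 1 := by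
    apply mul_right_cancel₀ hD0.ne'
    linear_combination (b 1 - a 1) * ht' - (d 1 - c 1) * hu' + (a 1 - c 1) * hD
  have hp : (1 - t) • a + t • b = (1 - u) • c + u • d := by
    ext i
    fin_cases i
    · simpa using e0
    · simpa using e1
  have p1 : 0 < t * (b 0 - a 0) := mul_pos ht0 (by linarith)
  have p2 : 0 < (1 - t) * (b 0 - a 0) := mul_pos (by linarith) (by linarith)
  have p3 : 0 < u * (d 1 - c 1) := mul_pos hu0 (by linarith)
  have p4 : 0 < (1 - u) * (d 1 - c 1) := mul_pos (by linarith) (by linarith)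
  refine ⟨(1 - t) • a + t • b, ⟨⟨1 - t, t, by linarith, by linarith, by ring, rfl⟩, ?_, ?_⟩,
    ⟨⟨1 - u, u, by linarith, by linarith, by ring, hp.symm⟩, ?_, ?_⟩⟩
  · intro h'
    have := congrArg (fun x : E2 => x 0) h'
    simp only [PiLp.add_apply, PiLp.smul_apply, smul_eq_mul] at this
    linarith
  · intro h'
    have := congrArg (fun x : E2 => x 0) h'
    simp only [PiLp.add_apply, PiLp.smul_apply, smul_eq_mul] at this
    linarith
  · intro h'
    rw [hp] at h'
    have := congrArg (fun x : E2 => x 1) h'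
    simp only [PiLp.add_apply, PiLp.smul_apply, smul_eq_mul] at this
    linarith
  · intro h'
    rw [hp] at h'
    have := congrArg (fun x : E2 => x 1) h'
    simp only [PiLp.add_apply, PiLp.smul_apply, smul_eq_mul] at this
    linarith

lemma hasCrossing_of (n : ℕ) (r h : ℝ) (hh : 0 < h) (hr : 10 * h ≤ r) (x : Fin n → E2)
    (i j k l : Fin n) (hi : x i ∈ bx 0 (4 * h) h)
    (hj : x j ∈ bx (8 * h) (4 * h) h) (hk : x k ∈ bx (4 * h) 0 h)
    (hl : x l ∈ bx (4 * h) (8 * h) h) : HasCrossing n r x := by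
  have hC := cross_of h hh _ _ _ _ hi hj hk hl
  obtain ⟨⟨a1, a2⟩, a3, a4⟩ := hi
  obtain ⟨⟨b1, b2⟩, b3, b4⟩ := hj
  obtain ⟨⟨c1, c2⟩, c3, c4⟩ := hk
  obtain ⟨⟨d1, d2⟩, d3, d4⟩ := hl
  refine ⟨i, j, k, l, ⟨?_, ?_⟩, ⟨?_, ?_⟩, ?_, hC⟩
  · rintro rfl; linarith
  · refine (dist_le' _ _ h hh.le ?_ ?_ (Or.inr ?_)).trans hr <;>
      exact abs_le.2 ⟨by linarith, by linarith⟩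
  · rintro rfl; linarith
  · refine (dist_le' _ _ h hh.le ?_ ?_ (Or.inl ?_)).trans hr <;>
      exact abs_le.2 ⟨by linarith, by linarith⟩
  · intro he
    have : i ∈ ({k, l} : Finset (Fin n)) := by rw [← he]; simp
    rw [Finset.mem_insert, Finset.mem_singleton] at this
    rcases this with rfl | rfl <;> linarith

lemma lower (n : ℕ) (r h : ℝ) (hh : 0 < h) (hr : 10 * h ≤ r) (h9 : 9 * h ≤ 1) :
    1 - 4 * ENNReal.ofReal (Real.exp (-(n * h ^ 2))) ≤ sqMeasure n {x | HasCrossing n r x} := by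
  have hcov : (Set.univ : Set (Fin n → E2)) ⊆ {x | HasCrossing n r x} ∪
      ({x | ∀ i, x i ∉ bx 0 (4 * h) h} ∪ {x | ∀ i, x i ∉ bx (8 * h) (4 * h) h} ∪
       {x | ∀ i, x i ∉ bx (4 * h) 0 h} ∪ {x | ∀ i, x i ∉ bx (4 * h) (8 * h) h}) := by
    intro x _
    by_contra hx
    simp only [Set.mem_union, Set.mem_ofPred_eq, not_or, not_forall, not_not] at hx
    obtain ⟨h0, ⟨⟨⟨i, hi⟩, j, hj⟩, k, hk⟩, l, hl⟩ := hx
    exact h0 (hasCrossing_of n r h hh hr x i j k l hi hj hk hl)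
  have hone : sqMeasure n Set.univ = 1 := by
    have : IsProbabilityMeasure (sqMeasure n) := by unfold sqMeasure; infer_instance
    exact measure_univ
  rw [tsub_le_iff_right, ← hone]
  refine (measure_mono hcov).trans ((measure_union_le _ _).trans ?_)
  gcongr
  refine (measure_union_le _ _).trans ?_
  refine (add_le_add_left ((measure_union_le _ _).trans
    (add_le_add_left (measure_union_le _ _) _)) _).trans ?_
  have m1 := miss n 0 (4 * h) h (by linarith) (by linarith) hh.le (by linarith) (by linarith)
  have m2 := miss n (8 * h) (4 * h) h (by linarith) (by linarith) hh.le (by linarith) (by linarith)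
  have m3 := miss n (4 * h) 0 h (by linarith) (by linarith) hh.le (by linarith) (by linarith)
  have m4 := miss n (4 * h) (8 * h) h (by linarith) (by linarith) hh.le (by linarith) (by linarith)
  refine (add_le_add (add_le_add (add_le_add m1 m2) m3) m4).trans (le_of_eq ?_)
  ring

theorem not_plane_above_connectivity (c : ℝ) (hc : 36 ≤ c) (r : ℕ → ℝ)
    (hrpos : ∀ n, 0 < r n)
    (hr : ∀ n : ℕ, 2 ≤ n → Real.sqrt (c * Real.log n / n) ≤ r n) :
    Tendsto (fun n : ℕ => sqMeasure n {x | HasCrossing n (r n) x}) atTop (nhds 1) := by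
  have hlogn : Tendsto (fun n : ℕ => Real.log n) atTop atTop :=
    Real.tendsto_log_atTop.comp tendsto_natCast_atTop_atTop
  have hlim : Tendsto (fun n : ℕ => 1 - 4 * ENNReal.ofReal (Real.exp (-(Real.log n / 4))))
      atTop (nhds 1) := by
    have h1 : Tendsto (fun n : ℕ => Real.exp (-(Real.log n / 4))) atTop (nhds 0) :=
      Real.tendsto_exp_neg_atTop_nhds_zero.comp (hlogn.atTop_div_const (by norm_num))
    have h2 := ENNReal.tendsto_ofReal h1
    have h3 := ENNReal.Tendsto.const_mul (a := 4) h2 (Or.inr (by norm_num))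
    have h4 := ENNReal.Tendsto.sub (tendsto_const_nhds (x := (1 : ENNReal))) h3
      (Or.inl (by norm_num))
    simpa using h4
  have hsmall : ∀ᶠ n : ℕ in atTop, Real.log n / n ≤ 1 / 81 := by
    have h1 : Tendsto (fun n : ℕ => Real.log n / n) atTop (nhds 0) :=
      (Real.isLittleO_log_id_atTop.tendsto_div_nhds_zero).comp tendsto_natCast_atTop_atTop
    exact h1.eventually_le_const (by norm_num)
  refine tendsto_of_tendsto_of_tendsto_of_le_of_le' hlim tendsto_const_nhds ?_ ?_
  · filter_upwards [hsmall, eventually_ge_atTop 2] with n hn hn2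
    have hnr : (2 : ℝ) ≤ n := by exact_mod_cast hn2
    have hl : 0 < Real.log n := Real.log_pos (by linarith)
    have hq : 0 < Real.log n / n := by positivity
    set s := Real.sqrt (Real.log n / n) with hs
    have hs2 : s ^ 2 = Real.log n / n := Real.sq_sqrt hq.le
    have hs0 : 0 < s := Real.sqrt_pos.2 hq
    have hs9 : s ≤ 1 / 9 := by
      rw [hs]; apply Real.sqrt_le_iff.2 ⟨by norm_num, by linarith⟩
    have hsr : 6 * s ≤ r n := by
      refine le_trans (Real.le_sqrt_of_sq_le ?_) (hr n hn2)
      rw [mul_pow, hs2, mul_div_assoc]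
      nlinarith
    have := lower n (r n) (s / 2) (by positivity) (by linarith) (by linarith)
    have he : (n : ℝ) * (s / 2) ^ 2 = Real.log n / 4 := by
      rw [div_pow, hs2]; field_simp; norm_num
    rwa [he] at this
  · refine Eventually.of_forall fun n => ?_
    have : IsProbabilityMeasure (sqMeasure n) := by unfold sqMeasure; infer_instance
    exact prob_le_one
end
end

section
/- Let a, b, c, d be points in the Euclidean plane ℝ² and r > 0. Suppose the segments [a,b] and [c,d] cross, i.e., they have a common point that is interior to both segments, and suppose ‖a−b‖ ≤ r and ‖c−d‖ ≤ r. Then one of the four points a, b, c, d is at Euclidean distance at most r from each of the other three points. -/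
noncomputable section

theorem crossing_anchor (a b c d : EuclideanSpace ℝ (Fin 2)) (r : ℝ) (hr : 0 < r)
    (hab : dist a b ≤ r) (hcd : dist c d ≤ r) (hx : Crosses a b c d) :
    ∃ p ∈ ({a, b, c, d} : Set (EuclideanSpace ℝ (Fin 2))),
      ∀ q ∈ ({a, b, c, d} : Set (EuclideanSpace ℝ (Fin 2))), q ≠ p → dist p q ≤ r := by
  obtain ⟨p, ⟨h1, -, -⟩, ⟨h2, -, -⟩⟩ := hx
  have e1 := dist_add_dist_of_mem_segment h1
  have e2 := dist_add_dist_of_mem_segment h2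
  have tac := dist_triangle a p c
  have tad := dist_triangle a p d
  have tbc := dist_triangle b p c
  have tbd := dist_triangle b p d
  have ca := dist_comm a p
  have cb := dist_comm b p
  have cc := dist_comm c p
  have cd := dist_comm d p
  have sab := dist_comm a b
  have scd := dist_comm c d
  have sac := dist_comm a c
  have sad := dist_comm a d
  have sbc := dist_comm b c
  have sbd := dist_comm b d
  have key : (dist a p ≤ dist c p ∧ dist a p ≤ dist d p) ∨
      (dist b p ≤ dist c p ∧ dist b p ≤ dist d p) ∨
      (dist c p ≤ dist a p ∧ dist c p ≤ dist b p) ∨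
      (dist d p ≤ dist a p ∧ dist d p ≤ dist b p) := by
    grind
  rcases key with h | h | h | h
  · refine ⟨a, by simp, ?_⟩
    rintro q (rfl | rfl | rfl | rfl) hq
    · exact absurd rfl hq
    all_goals linarith
  · refine ⟨b, by simp, ?_⟩
    rintro q (rfl | rfl | rfl | rfl) hq
    · linarith
    · exact absurd rfl hq
    all_goals linarith
  · refine ⟨c, by simp, ?_⟩
    rintro q (rfl | rfl | rfl | rfl) hq
    · linarith
    · linarith
    · exact absurd rfl hq
    · linarith
  · refine ⟨d, by simp, ?_⟩
    rintro q (rfl | rfl | rfl | rfl) hq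
    · linarith
    · linarith
    · linarith
    · exact absurd rfl hq
end
end
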